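/- arXiv:2002.02912 — 7 statements merged into one kernel-verified Lean document; each statement's English description precedes it below -/
import Mathlib

section
/- Let G be a finite group acting faithfully on a finite type N. Consider single-hidden-layer G-invariant networks of the form ψ̂(x) = Σ_{c=1}^{C} w'_c · Σ_{h ∈ G} ReLU( (Σ_{i ∈ N} Φ_c(h, i) · x(i)) + b_c ), where the hidden layer is indexed by G itself carrying the right regular action g • h = h g⁻¹, and each weight matrix Φ_c : G × N → ℝ satisfies the parameter-sharing (equivariance) constraint Φ_c(g • h, g • i) = Φ_c(h, i) for all g ∈ G, h ∈ G, i ∈ N. Then for every continuous G-invariant function ψ : (N → ℝ) → ℝ, every compact set K ⊆ (N → ℝ), and every ε > 0, there exist C ∈ ℕ, weight matrices Φ_1, …, Φ_C satisfying the parameter-sharing constraint, and scalars b_1, …, b_C, w'_1, …, w'_C ∈ ℝ such that |ψ(x) − ψ̂(x)| ≤ ε for all x ∈ K. -/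
/-- The affine ridge function `x ↦ ReLU (v ⬝ x + b)`. -/
def reluRidge {N : Type*} [Fintype N] (v : N → ℝ) (b : ℝ) : C(N → ℝ, ℝ) where
  toFun x := max 0 ((∑ i, v i * x i) + b)
  continuous_toFun := by fun_prop

/-- The space of single-hidden-layer ReLU networks on `N → ℝ`. -/
def reluSpan (N : Type*) [Fintype N] : Submodule ℝ C(N → ℝ, ℝ) :=
  Submodule.span ℝ {f | ∃ v b, f = reluRidge v b}

theorem reluRidge_mem_reluSpan {N : Type*} [Fintype N] (v : N → ℝ) (b : ℝ) :
    reluRidge v b ∈ reluSpan N :=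
  Submodule.subset_span ⟨v, b, rfl⟩

/-- A function of one linear form whose increments over steps of length `δ` are at most `η` is
approximated within `2 * η` by a ReLU network which is constant beyond the last node. -/
theorem exists_mem_reluSpan_of_grid {N : Type*} [Fintype N] (v : N → ℝ) (f : ℝ → ℝ)
    {a M δ η : ℝ} (hδ : 0 < δ)
    (hf : ∀ s ∈ Set.Icc a (a + M), ∀ t ∈ Set.Icc a (a + M), |s - t| ≤ δ → |f s - f t| ≤ η)
    (n : ℕ) (hn : n * δ ≤ M) :
    ∃ F ∈ reluSpan N, ∀ x : N → ℝ, a ≤ ∑ i, v i * x i →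
      (∑ i, v i * x i ≤ a + n * δ → |f (∑ i, v i * x i) - F x| ≤ 2 * η) ∧
      (a + n * δ ≤ ∑ i, v i * x i → F x = f (a + n * δ)) := by
  induction n with
  | zero =>
    refine ⟨f a • reluRidge 0 1, Submodule.smul_mem _ _ (reluRidge_mem_reluSpan _ _), ?_⟩
    intro x hx
    have hM : 0 ≤ M := by simpa using hn
    have hη : 0 ≤ η := by
      have := hf a ⟨le_rfl, by linarith⟩ a ⟨le_rfl, by linarith⟩ (by simpa using hδ.le)
      simpa using this
    have hval : (f a • reluRidge (0 : N → ℝ) 1) x = f a := by simp [reluRidge]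
    rw [hval]
    refine ⟨fun h => ?_, fun _ => by simp⟩
    have : ∑ i, v i * x i = a := le_antisymm (by simpa using h) hx
    rw [this]
    simpa using hη
  | succ n ih =>
    push_cast at hn
    obtain ⟨F, hF, hFx⟩ := ih (by nlinarith)
    set t₀ : ℝ := a + n * δ with ht₀
    have hnδ : 0 ≤ (n : ℝ) * δ := by positivity
    have ht₁ : a + ((n + 1 : ℕ) : ℝ) * δ = t₀ + δ := by push_cast; ring
    rw [ht₁]
    have hstep : |f (t₀ + δ) - f t₀| ≤ η :=
      hf _ ⟨by linarith, by linarith⟩ _ ⟨by linarith, by linarith⟩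
        (by rw [add_sub_cancel_left, abs_of_pos hδ])
    refine ⟨F + ((f (t₀ + δ) - f t₀) / δ) • (reluRidge v (-t₀) - reluRidge v (-(t₀ + δ))),
      add_mem hF (Submodule.smul_mem _ _ (sub_mem (reluRidge_mem_reluSpan _ _)
        (reluRidge_mem_reluSpan _ _))), fun x hx => ?_⟩
    obtain ⟨h₁, h₂⟩ := hFx x hx
    have hval : (F + ((f (t₀ + δ) - f t₀) / δ) •
        (reluRidge v (-t₀) - reluRidge v (-(t₀ + δ)))) x =
        F x + (f (t₀ + δ) - f t₀) / δ * (max 0 ((∑ i, v i * x i) + -t₀) -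
          max 0 ((∑ i, v i * x i) + -(t₀ + δ))) := rfl
    rw [hval]
    set t : ℝ := ∑ i, v i * x i with ht
    refine ⟨fun hle => ?_, fun hge => ?_⟩
    · rcases le_total t t₀ with h | h
      · rw [max_eq_left (by linarith), max_eq_left (by linarith)]
        simpa using h₁ h
      · rw [max_eq_right (by linarith), max_eq_left (by linarith), h₂ h]
        have ha : |f t - f t₀| ≤ η :=
          hf _ ⟨hx, by linarith⟩ _ ⟨by linarith, by linarith⟩
            (by rw [abs_of_nonneg (by linarith)]; linarith)
        have hr₁ : |(t + -t₀ - 0) / δ| ≤ 1 := by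
          rw [abs_of_nonneg (div_nonneg (by linarith) hδ.le), div_le_one hδ]
          linarith
        have hb : |(f (t₀ + δ) - f t₀) / δ * (t + -t₀ - 0)| ≤ η := by
          rw [div_mul_eq_mul_div, mul_div_assoc, abs_mul]
          calc _ ≤ |f (t₀ + δ) - f t₀| * 1 := by gcongr
            _ ≤ η := by simpa using hstep
        calc _ = |(f t - f t₀) - (f (t₀ + δ) - f t₀) / δ * (t + -t₀ - 0)| := by
              congr 1; ring
          _ ≤ _ := abs_sub _ _
          _ ≤ 2 * η := by linarith
    · rw [max_eq_right (by linarith), max_eq_right (by linarith), h₂ (by linarith)]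
      field_simp
      ring

/-- Continuous functions of one linear form are approximated by ReLU networks on sets where the
form is bounded. -/
theorem exists_mem_reluSpan_ridge_approx {N : Type*} [Fintype N] (v : N → ℝ) {f : ℝ → ℝ}
    (hf : Continuous f) (R : ℝ) {ε : ℝ} (hε : 0 < ε) :
    ∃ F ∈ reluSpan N, ∀ x : N → ℝ, |∑ i, v i * x i| ≤ R →
      |f (∑ i, v i * x i) - F x| ≤ ε := by
  rcases lt_or_ge R 0 with hR | hR
  · exact ⟨0, zero_mem _, fun x hx => absurd ((abs_nonneg _).trans hx) (not_le.mpr hR)⟩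
  have huc : UniformContinuousOn f (Set.Icc (-R) (-R + (2 * R + 1))) :=
    isCompact_Icc.uniformContinuousOn_of_continuous hf.continuousOn
  obtain ⟨δ, hδ, hfδ⟩ := Metric.uniformContinuousOn_iff.mp huc (ε / 2) (by positivity)
  obtain ⟨n, hn⟩ := exists_nat_gt ((2 * R + 1) / δ)
  have hn₀ : (0 : ℝ) < n := lt_of_le_of_lt (by positivity) hn
  have hsmall : (2 * R + 1) / n < δ := by
    rw [div_lt_iff₀ hδ] at hn
    rw [div_lt_iff₀ hn₀]
    linarith
  have hmul : (n : ℝ) * ((2 * R + 1) / n) = 2 * R + 1 := by field_simp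
  obtain ⟨F, hF, hFx⟩ := exists_mem_reluSpan_of_grid v f (a := -R) (M := 2 * R + 1)
    (δ := (2 * R + 1) / n) (η := ε / 2) (by positivity)
    (fun s hs t ht hst => (hfδ s hs t ht (lt_of_le_of_lt hst hsmall)).le) n hmul.le
  refine ⟨F, hF, fun x hx => ?_⟩
  obtain ⟨hl, hu⟩ := abs_le.mp hx
  have := (hFx x hl).1 (by rw [hmul]; linarith)
  linarith

/-- The exponentials of linear forms, restricted to `K`. -/
def expLinearSubmonoid {N : Type*} [Fintype N] (K : Set (N → ℝ)) : Submonoid C(K, ℝ) where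
  carrier := {f | ∃ v : N → ℝ, ∀ x : K, f x = Real.exp (∑ i, v i * x.1 i)}
  one_mem' := ⟨0, fun x => by simp⟩
  mul_mem' := by
    rintro f g ⟨v, hv⟩ ⟨w, hw⟩
    refine ⟨v + w, fun x => ?_⟩
    simp [hv, hw, ← Real.exp_add, add_mul, Finset.sum_add_distrib]

theorem adjoin_expLinearSubmonoid_topologicalClosure {N : Type*} [Fintype N] (K : Set (N → ℝ))
    [CompactSpace K] :
    (Algebra.adjoin ℝ (expLinearSubmonoid K : Set C(K, ℝ))).topologicalClosure = ⊤ := by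
  classical
  refine ContinuousMap.subalgebra_topologicalClosure_eq_top_of_separatesPoints _ ?_
  intro x y hxy
  obtain ⟨i, hi⟩ := Function.ne_iff.mp (fun h => hxy (Subtype.ext h))
  have hcont (v : N → ℝ) : Continuous fun x : K => Real.exp (∑ j, v j * x.1 j) :=
    (show Continuous fun x : N → ℝ => Real.exp (∑ j, v j * x j) by fun_prop).comp
      continuous_subtype_val
  let f : C(K, ℝ) := ⟨_, hcont (Pi.single i 1)⟩
  refine ⟨f, ⟨f, Algebra.subset_adjoin ⟨Pi.single i 1, fun x => rfl⟩, rfl⟩, ?_⟩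
  simpa [f, Pi.single_apply] using hi

/-- Single-hidden-layer ReLU networks are dense in the continuous functions on a compact set. -/
theorem exists_mem_reluSpan_approx {N : Type*} [Fintype N] {K : Set (N → ℝ)} (hK : IsCompact K)
    {f : (N → ℝ) → ℝ} (hf : Continuous f) {ε : ℝ} (hε : 0 < ε) :
    ∃ F ∈ reluSpan N, ∀ x ∈ K, |f x - F x| ≤ ε := by
  have : CompactSpace K := isCompact_iff_compactSpace.mp hK
  let r : C(N → ℝ, ℝ) →ₗ[ℝ] C(K, ℝ) :=
    (ContinuousMap.compRightAlgHom ℝ ℝ (⟨Subtype.val, continuous_subtype_val⟩ : C(K, N → ℝ)))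
      |>.toLinearMap
  let W : Submodule ℝ C(K, ℝ) := ((reluSpan N).map r).topologicalClosure
  have hexp : (expLinearSubmonoid K : Set C(K, ℝ)) ⊆ W := by
    rintro g ⟨v, hv⟩
    refine Metric.mem_closure_iff.mpr fun η hη => ?_
    obtain ⟨R, hR⟩ := hK.exists_bound_of_continuousOn (f := fun x : N → ℝ => ∑ i, v i * x i)
      (by fun_prop)
    obtain ⟨F, hF, hFx⟩ := exists_mem_reluSpan_ridge_approx v Real.continuous_exp R (half_pos hη)
    refine ⟨r F, ⟨F, hF, rfl⟩, lt_of_le_of_lt ?_ (half_lt_self hη)⟩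
    refine (ContinuousMap.dist_le (half_pos hη).le).mpr fun x => ?_
    rw [Real.dist_eq, hv]
    exact hFx x (hR x x.2)
  have hadj : ((Algebra.adjoin ℝ (expLinearSubmonoid K : Set C(K, ℝ)) : Subalgebra ℝ C(K, ℝ)) :
      Set C(K, ℝ)) ⊆ W := by
    intro g hg
    have hg' : g ∈ Subalgebra.toSubmodule
      (Algebra.adjoin ℝ (expLinearSubmonoid K : Set C(K, ℝ))) := hg
    rw [Algebra.adjoin_eq_span, Submonoid.closure_eq] at hg'
    exact Submodule.span_le.mpr hexp hg'
  let fK : C(K, ℝ) := ⟨fun x => f x, by fun_prop⟩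
  have hfK : fK ∈ (Algebra.adjoin ℝ (expLinearSubmonoid K : Set C(K, ℝ))).topologicalClosure := by
    rw [adjoin_expLinearSubmonoid_topologicalClosure]
    trivial
  have hfW : fK ∈ closure (((reluSpan N).map r : Submodule ℝ C(K, ℝ)) : Set C(K, ℝ)) :=
    closure_minimal hadj isClosed_closure hfK
  obtain ⟨_, ⟨F, hF, rfl⟩, hd⟩ := Metric.mem_closure_iff.mp hfW ε hε
  refine ⟨F, hF, fun x hx => ?_⟩
  exact (ContinuousMap.dist_apply_le_dist (f := fK) (g := r F) ⟨x, hx⟩).trans hd.le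

/-- **Universality of invariant MLPs with a regular hidden layer.**
Let `G` be a finite group acting faithfully on a finite type `N`.  Single-hidden-layer
`G`-invariant networks with hidden layer indexed by `G` carrying the right regular action
`g • h = h * g⁻¹`, whose first-layer weights `Φ c : G → N → ℝ` satisfy the parameter-sharing
constraint `Φ c (h * g⁻¹) (g • i) = Φ c h i`, can approximate any continuous `G`-invariant
function uniformly on compact sets. -/
theorem invariant_regular_universality
    {G : Type*} [Group G] [Fintype G] {N : Type*} [Fintype N]
    [MulAction G N] [FaithfulSMul G N]
    (ψ : (N → ℝ) → ℝ) (hcont : Continuous ψ)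
    (hinv : ∀ (g : G) (x : N → ℝ), ψ (fun i => x (g⁻¹ • i)) = ψ x)
    (K : Set (N → ℝ)) (hK : IsCompact K) (ε : ℝ) (hε : 0 < ε) :
    ∃ (C : ℕ) (Φ : Fin C → G → N → ℝ) (b w' : Fin C → ℝ),
      (∀ (c : Fin C) (g h : G) (i : N), Φ c (h * g⁻¹) (g • i) = Φ c h i) ∧
      ∀ x ∈ K,
        |ψ x - ∑ c : Fin C, w' c *
            ∑ h : G, max 0 ((∑ i : N, Φ c h i * x i) + b c)| ≤ ε := by
  classical
  have hK' : IsCompact (⋃ g : G, (fun x : N → ℝ => fun i => x (g⁻¹ • i)) '' K) :=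
    isCompact_iUnion fun g => hK.image (by fun_prop)
  obtain ⟨F, hF, hFx⟩ := exists_mem_reluSpan_approx hK' hcont hε
  obtain ⟨C, w, u, hwu⟩ := Submodule.mem_span_set'.mp hF
  choose v b hvb using fun c => (u c).2
  have hcard : (0 : ℝ) < Fintype.card G := by exact_mod_cast Fintype.card_pos
  refine ⟨C, fun c h i => v c (h • i), b, fun c => w c / Fintype.card G, ?_, fun x hx => ?_⟩
  · intro c g h i
    simp [smul_smul]
  have hF_apply : ∀ y, F y = ∑ c, w c * max 0 ((∑ i, v c i * y i) + b c) := by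
    intro y
    rw [← hwu]
    simp [hvb, reluRidge, ContinuousMap.sum_apply]
  have hshift : ∀ (c : Fin C) (h : G),
      ∑ i, v c (h • i) * x i = ∑ i, v c i * x (h⁻¹ • i) := fun c h =>
    Fintype.sum_equiv (MulAction.toPerm h) _ _ fun i => by simp
  have hnet : ∑ c : Fin C, w c / Fintype.card G *
      ∑ h : G, max 0 ((∑ i : N, v c (h • i) * x i) + b c) =
      (∑ h : G, F fun i => x (h⁻¹ • i)) / Fintype.card G := by
    simp_rw [hF_apply, hshift]
    rw [Finset.sum_comm, Finset.sum_div]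
    refine Finset.sum_congr rfl fun c _ => ?_
    rw [← Finset.mul_sum]
    ring
  have hψ : ψ x = (∑ h : G, ψ fun i => x (h⁻¹ • i)) / Fintype.card G := by
    simp_rw [hinv]
    simp
  rw [hnet, hψ, ← sub_div, ← Finset.sum_sub_distrib, abs_div, abs_of_pos hcard, div_le_iff₀ hcard]
  calc _ ≤ ∑ h : G, |ψ (fun i => x (h⁻¹ • i)) - F fun i => x (h⁻¹ • i)| :=
        Finset.abs_sum_le_sum_abs _ _
    _ ≤ ∑ _h : G, ε := Finset.sum_le_sum fun h _ =>
        hFx _ (Set.mem_iUnion.mpr ⟨h, x, hx, rfl⟩)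
    _ = ε * Fintype.card G := by simp [mul_comm]
end

section
/- Fix m ∈ ℕ and n : Fin m → ℕ with n(k) ≥ 1 for all k, and let T = Π_{k : Fin m} ZMod (n k), an abelian group acting on itself by translation. Call ψ : (T → ℝ) → (T → ℝ) circular-translation equivariant if for every t ∈ T and every x, ψ(u ↦ x(u + t)) = (u ↦ ψ(x)(u + t)). Then for every continuous circular-translation equivariant ψ, every compact K ⊆ (T → ℝ), and every ε > 0, there exist C ∈ ℕ, kernels w_c : T → ℝ, w'_c : T → ℝ, and biases b_c ∈ ℝ such that the two-layer circular convolutional network ψ̂(x)(u) = Σ_{c=1}^{C} Σ_{s ∈ T} w'_c(s) · ReLU( (Σ_{v ∈ T} w_c(v) · x(u + s + v)) + b_c ) satisfies max_{u ∈ T} |ψ(x)(u) − ψ̂(x)(u)| ≤ ε for all x ∈ K. -/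
/-- The one-dimensional step of the universal approximation theorem: a submodule of `C(X, ℝ)`
containing the constants and all `ReLU (ℓ - a)` is dense among the functions of `ℓ`. -/
theorem comp_mem_topologicalClosure_of_relu_mem {X : Type*} [TopologicalSpace X] [CompactSpace X]
    (S : Submodule ℝ C(X, ℝ)) (ℓ : C(X, ℝ)) (h_one : (1 : C(X, ℝ)) ∈ S)
    (h_relu : ∀ a : ℝ, (⟨fun x => max 0 (ℓ x - a), by fun_prop⟩ : C(X, ℝ)) ∈ S) (g : C(ℝ, ℝ)) :
    g.comp ℓ ∈ S.topologicalClosure := by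
  have hR : ∀ x, -‖ℓ‖ ≤ ℓ x ∧ ℓ x ≤ ‖ℓ‖ := fun x => abs_le.1 (ℓ.norm_coe_le_norm x)
  set R := ‖ℓ‖
  have hg : UniformContinuousOn g (Set.Icc (-R) (R + 1)) :=
    isCompact_Icc.uniformContinuousOn_of_continuous g.continuous.continuousOn
  rw [← SetLike.mem_coe, Submodule.topologicalClosure_coe, Metric.mem_closure_iff]
  intro ε hε
  obtain ⟨δ', hδ', hδg⟩ := Metric.uniformContinuousOn_iff.1 hg (ε / 2) (half_pos hε)
  obtain ⟨δ, hδ, hδlt⟩ := exists_between (lt_min hδ' one_pos)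
  have hδ1 : δ < 1 := hδlt.trans_le (min_le_right _ _)
  have hδδ' : δ < δ' := hδlt.trans_le (min_le_left _ _)
  have approx : ∀ N : ℕ, -R + N * δ ≤ R + 1 → ∃ h ∈ S, ∀ x,
      (ℓ x ≤ -R + N * δ → |g (ℓ x) - h x| ≤ ε / 2) ∧
      (-R + N * δ ≤ ℓ x → h x = g (-R + N * δ)) := by
    intro N
    induction N with
    | zero =>
      intro _
      refine ⟨g (-R) • 1, S.smul_mem _ h_one, fun x => ⟨fun hx => ?_, fun _ => by simp⟩⟩
      have : ℓ x = -R := le_antisymm (by simpa using hx) (hR x).1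
      simpa [this] using (half_pos hε).le
    | succ N ih =>
      intro hN
      push_cast at hN ⊢
      obtain ⟨h, hS, hh⟩ := ih (by linarith)
      have hN0 : 0 ≤ N * δ := by positivity
      set a := -R + N * δ with ha
      have ha' : -R + (N + 1) * δ = a + δ := by rw [ha]; ring
      rw [ha'] at hN ⊢
      refine ⟨h + ((g (a + δ) - g a) / δ) • (⟨fun x => max 0 (ℓ x - a), by fun_prop⟩ -
        ⟨fun x => max 0 (ℓ x - (a + δ)), by fun_prop⟩),
        S.add_mem hS (S.smul_mem _ (S.sub_mem (h_relu _) (h_relu _))), fun x => ?_⟩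
      simp only [ContinuousMap.add_apply, ContinuousMap.smul_apply, ContinuousMap.sub_apply,
        ContinuousMap.coe_mk, smul_eq_mul]
      refine ⟨fun hx => ?_, fun hx => ?_⟩
      · rw [max_eq_left (by linarith : ℓ x - (a + δ) ≤ 0)]
        rcases le_total (ℓ x) a with hxa | hxa
        · rw [max_eq_left (by linarith : ℓ x - a ≤ 0)]
          simpa using (hh x).1 hxa
        · rw [max_eq_right (by linarith : 0 ≤ ℓ x - a), (hh x).2 hxa]
          have hx_mem : ℓ x ∈ Set.Icc (-R) (R + 1) := ⟨(hR x).1, by linarith⟩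
          have h₀ := (hδg _ hx_mem a ⟨by linarith, by linarith⟩
            (by rw [Real.dist_eq, abs_lt]; constructor <;> linarith)).le
          have h₁ := (hδg _ hx_mem (a + δ) ⟨by linarith, hN⟩
            (by rw [Real.dist_eq, abs_lt]; constructor <;> linarith)).le
          rw [Real.dist_eq] at h₀ h₁
          set t := (ℓ x - a) / δ with ht
          have ht0 : 0 ≤ t := div_nonneg (by linarith) hδ.le
          have ht1 : t ≤ 1 := (div_le_one hδ).2 (by linarith)
          have key : g (ℓ x) - (g a + (g (a + δ) - g a) / δ * (ℓ x - a - 0)) =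
              (1 - t) * (g (ℓ x) - g a) + t * (g (ℓ x) - g (a + δ)) := by
            rw [ht]; field_simp; ring
          rw [key]
          calc |(1 - t) * (g (ℓ x) - g a) + t * (g (ℓ x) - g (a + δ))|
              ≤ (1 - t) * |g (ℓ x) - g a| + t * |g (ℓ x) - g (a + δ)| := by
                refine (abs_add_le _ _).trans_eq ?_
                rw [abs_mul, abs_mul, abs_of_nonneg ht0, abs_of_nonneg (sub_nonneg.2 ht1)]
            _ ≤ (1 - t) * (ε / 2) + t * (ε / 2) := by
                have := sub_nonneg.2 ht1
                gcongr
            _ = ε / 2 := by ring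
      · rw [max_eq_right (by linarith : 0 ≤ ℓ x - a),
          max_eq_right (by linarith : 0 ≤ ℓ x - (a + δ)), (hh x).2 (by linarith)]
        field_simp
        ring
  have hR0 : 0 ≤ R := norm_nonneg ℓ
  obtain ⟨h, hS, hh⟩ := approx ⌈2 * R / δ⌉₊ (by
    have := mul_lt_mul_of_pos_right (Nat.ceil_lt_add_one (by positivity : 0 ≤ 2 * R / δ)) hδ
    rw [add_mul, div_mul_cancel₀ _ hδ.ne'] at this
    linarith)
  refine ⟨h, hS, lt_of_le_of_lt ?_ (half_lt_self hε)⟩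
  refine (ContinuousMap.dist_le (half_pos hε).le).2 fun x => (hh x).1 ?_
  have := mul_le_mul_of_nonneg_right (Nat.le_ceil (2 * R / δ)) hδ.le
  rw [div_mul_cancel₀ _ hδ.ne'] at this
  linarith [(hR x).2]

/-- The linear functional `x ↦ ∑ i, w i * x i` restricted to a set `K`. -/
def linearOn {ι : Type*} [Fintype ι] (K : Set (ι → ℝ)) (w : ι → ℝ) : C(K, ℝ) where
  toFun x := ∑ i, w i * x.1 i
  continuous_toFun := continuous_finsetSum _ fun i _ =>
    continuous_const.mul ((continuous_apply i).comp continuous_subtype_val)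

/-- The neuron `x ↦ ReLU (∑ i, w i * x i + b)` restricted to a set `K`. -/
def reluNeuron {ι : Type*} [Fintype ι] (K : Set (ι → ℝ)) (p : (ι → ℝ) × ℝ) : C(K, ℝ) :=
  ⟨fun x => max 0 (linearOn K p.1 x + p.2), by fun_prop⟩

/-- The exponential `x ↦ exp (∑ i, w i * x i)` restricted to a set `K`, as a character in `w`. -/
noncomputable def expCharacter {ι : Type*} [Fintype ι] (K : Set (ι → ℝ)) :
    Multiplicative (ι → ℝ) →* C(K, ℝ) where
  toFun w := ⟨fun x => Real.exp (linearOn K w.toAdd x), by fun_prop⟩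
  map_one' := by ext; simp [linearOn]
  map_mul' w w' := by ext; simp [linearOn, add_mul, Finset.sum_add_distrib, Real.exp_add]

/-- Linear combinations of exponentials are dense in the continuous functions on a compact set. -/
theorem topologicalClosure_span_range_expCharacter {ι : Type*} [Fintype ι] (K : Set (ι → ℝ))
    [CompactSpace K] :
    (Submodule.span ℝ (Set.range (expCharacter K))).topologicalClosure = ⊤ := by
  classical
  have hspan : Subalgebra.toSubmodule (Algebra.adjoin ℝ (Set.range (expCharacter K))) =
      Submodule.span ℝ (Set.range (expCharacter K)) := by
    rw [Algebra.adjoin_eq_span, ← MonoidHom.coe_mrange, Submonoid.closure_eq]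
  have hdense := ContinuousMap.subalgebra_topologicalClosure_eq_top_of_separatesPoints
    (Algebra.adjoin ℝ (Set.range (expCharacter K))) (by
      intro x y hxy
      obtain ⟨i, hi⟩ := Function.ne_iff.1 (Subtype.coe_injective.ne hxy)
      refine ⟨_, ⟨expCharacter K (Multiplicative.ofAdd (Pi.single i 1)),
        Algebra.subset_adjoin ⟨_, rfl⟩, rfl⟩, ?_⟩
      simpa [expCharacter, linearOn, Pi.single_apply] using hi)
  rw [← hspan]
  ext f
  have hf : f ∈ (Algebra.adjoin ℝ (Set.range (expCharacter K))).topologicalClosure :=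
    hdense ▸ Algebra.mem_top
  exact iff_of_true hf Submodule.mem_top

/-- **Universal approximation** by ReLU networks with one hidden layer, on a compact set. -/
theorem topologicalClosure_span_range_reluNeuron {ι : Type*} [Fintype ι] (K : Set (ι → ℝ))
    [CompactSpace K] :
    (Submodule.span ℝ (Set.range (reluNeuron K))).topologicalClosure = ⊤ := by
  rw [eq_top_iff, ← topologicalClosure_span_range_expCharacter K]
  refine Submodule.topologicalClosure_minimal _ (Submodule.span_le.2 ?_)
    (Submodule.isClosed_topologicalClosure _)
  rintro _ ⟨w, rfl⟩
  refine comp_mem_topologicalClosure_of_relu_mem _ (linearOn K w.toAdd) ?_ (fun a => ?_) ⟨Real.exp, by fun_prop⟩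
  · refine Submodule.subset_span ⟨(0, 1), ?_⟩
    ext x
    simp [reluNeuron, linearOn]
  · refine Submodule.subset_span ⟨(w.toAdd, -a), ?_⟩
    ext x
    simp [reluNeuron, sub_eq_add_neg]

/-- **Universality of CNNs with a single hidden layer.**
Over the torus group `T = Π k : Fin m, ZMod (n k)` (with every `n k ≥ 1`, expressed as
`NeZero (n k)`), every continuous circular-translation equivariant function
`ψ : (T → ℝ) → (T → ℝ)` can be approximated uniformly on compact sets by a two-layer
circular convolutional network with full kernels and cyclic padding. -/
theorem cnn_universality
    (m : ℕ) (n : Fin m → ℕ) [∀ k, NeZero (n k)]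
    (ψ : ((∀ k, ZMod (n k)) → ℝ) → ((∀ k, ZMod (n k)) → ℝ))
    (hcont : Continuous ψ)
    (hequiv : ∀ (t : ∀ k, ZMod (n k)) (x : (∀ k, ZMod (n k)) → ℝ),
      ψ (fun u => x (u + t)) = fun u => ψ x (u + t))
    (K : Set ((∀ k, ZMod (n k)) → ℝ)) (hK : IsCompact K) (ε : ℝ) (hε : 0 < ε) :
    ∃ (C : ℕ) (w w' : Fin C → (∀ k, ZMod (n k)) → ℝ) (b : Fin C → ℝ),
      ∀ x ∈ K, ∀ u : ∀ k, ZMod (n k),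
        |ψ x u - ∑ c : Fin C, ∑ s : ∀ k, ZMod (n k),
            w' c s * max 0 ((∑ v : ∀ k, ZMod (n k), w c v * x (u + s + v)) + b c)| ≤ ε := by
  classical
  let translate (u : ∀ k, ZMod (n k)) (x : (∀ k, ZMod (n k)) → ℝ) : (∀ k, ZMod (n k)) → ℝ :=
    fun v => x (v + u)
  have htranslate (u) : Continuous (translate u) := by fun_prop
  let L := ⋃ u, translate u '' K
  have hL : IsCompact L := isCompact_iUnion fun u => hK.image (htranslate u)
  have : CompactSpace L := isCompact_iff_compactSpace.1 hL
  let f : C(L, ℝ) := ⟨fun x => ψ x 0, by fun_prop⟩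
  have hf : f ∈ (Submodule.span ℝ (Set.range (reluNeuron L))).topologicalClosure :=
    topologicalClosure_span_range_reluNeuron L ▸ Submodule.mem_top
  rw [← SetLike.mem_coe, Submodule.topologicalClosure_coe, Metric.mem_closure_iff] at hf
  obtain ⟨h, hS, hdist⟩ := hf ε hε
  obtain ⟨C, c, p, rfl⟩ := Submodule.mem_span_set'.1 hS
  choose q hq using fun i => (p i).2
  refine ⟨C, fun i => (q i).1, fun i => Pi.single 0 (c i), fun i => (q i).2, fun x hx u => ?_⟩
  have hmem : translate u x ∈ L := Set.mem_iUnion.2 ⟨u, x, hx, rfl⟩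
  have hψ : f ⟨translate u x, hmem⟩ = ψ x u := by
    simpa [f, translate] using congrFun (hequiv u x) 0
  have hle := (ContinuousMap.dist_apply_le_dist ⟨translate u x, hmem⟩).trans hdist.le
  rw [hψ, Real.dist_eq, ContinuousMap.sum_apply] at hle
  refine le_of_eq_of_le (congrArg (fun y => |ψ x u - y|) (Finset.sum_congr rfl fun i _ => ?_)) hle
  rw [ContinuousMap.smul_apply, ← hq i,
    Finset.sum_eq_single 0 (fun s _ hs => by simp [hs]) (by simp)]
  simp [reluNeuron, linearOn, translate, add_comm]
end

section
/- Let G be a finite group acting faithfully and transitively on a finite nonempty type X, and let H be the stabilizer of some point x₀ ∈ X. If D ≥ 1 and 2^(D−1) ≥ |H| (i.e., D ≥ log₂|H| + 1), then there exists a tuple v : Fin D → X whose stabilizer under the diagonal action of G on (Fin D → X), namely ⋂_{d} Stab(v(d)), is the trivial subgroup; that is, the order-D product space X^D contains a regular orbit. -/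
/-- The infimum of a family indexed by `Fin (n + 1)` splits off its first term. -/
theorem Fin.iInf_eq_zero_inf_succ {α : Type*} [CompleteLattice α] {n : ℕ} (f : Fin (n + 1) → α) :
    ⨅ i, f i = f 0 ⊓ ⨅ i : Fin n, f i.succ :=
  eq_of_forall_le_iff fun a ↦ by simp [Fin.forall_fin_succ]

/-- A proper subgroup of a finite subgroup has at most half its order. -/
theorem Subgroup.two_mul_card_le_of_lt {G : Type*} [Group G] [Finite G] {L K : Subgroup G}
    (h : L < K) : 2 * Nat.card L ≤ Nat.card K := by
  obtain ⟨c, hc⟩ := Subgroup.card_dvd_of_le h.le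
  have hlt : Nat.card L < Nat.card K := by
    by_contra! hge
    exact h.ne (Subgroup.eq_of_le_of_card_ge h.le hge)
  have hc2 : 2 ≤ c := by
    by_contra! hlt2
    interval_cases c <;> omega
  rw [hc, mul_comm]
  exact Nat.mul_le_mul_left _ hc2

/-- A nontrivial subgroup of a group acting faithfully moves some point. -/
theorem MulAction.exists_inf_stabilizer_lt {G X : Type*} [Group G] [MulAction G X]
    [FaithfulSMul G X] {K : Subgroup G} (hK : K ≠ ⊥) :
    ∃ x : X, K ⊓ stabilizer G x < K := by
  obtain ⟨g, hg, hg1⟩ := K.ne_bot_iff_exists_ne_one.mp hK |>.imp fun g hg ↦ And.intro g.2 hg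
  obtain ⟨x, hx⟩ : ∃ x : X, (g : G) • x ≠ x := by
    by_contra! hfix
    exact hg1 (Subtype.ext (FaithfulSMul.eq_of_smul_eq_smul fun x : X ↦ by simpa using hfix x))
  exact ⟨x, inf_lt_left.mpr fun hle ↦ hx (mem_stabilizer_iff.mp (hle hg))⟩

/-- In a faithful action, a subgroup of order at most `2 ^ n` meets the stabilizer of some
`n`-tuple trivially. -/
theorem MulAction.exists_inf_iInf_stabilizer_eq_bot {G X : Type*} [Group G] [Finite G]
    [Nonempty X] [MulAction G X] [FaithfulSMul G X] {n : ℕ} {K : Subgroup G}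
    (hK : Nat.card K ≤ 2 ^ n) :
    ∃ v : Fin n → X, K ⊓ ⨅ d, stabilizer G (v d) = ⊥ := by
  induction n generalizing K with
  | zero => exact ⟨Fin.elim0, by rw [K.eq_bot_of_card_le (by simpa using hK), bot_inf_eq]⟩
  | succ n ih =>
    by_cases hbot : K = ⊥
    · exact ⟨fun _ ↦ Classical.arbitrary X, by rw [hbot, bot_inf_eq]⟩
    · obtain ⟨x, hx⟩ := exists_inf_stabilizer_lt (X := X) hbot
      have hcard := Subgroup.two_mul_card_le_of_lt hx
      obtain ⟨v, hv⟩ := ih (K := K ⊓ stabilizer G x) (by rw [pow_succ] at hK; omega)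
      refine ⟨Fin.cons x v, ?_⟩
      rw [Fin.iInf_eq_zero_inf_succ, ← inf_assoc]
      simpa using hv

/-- **Regular orbits in high-order product spaces (group-specific bound).**
Let `G` be a finite group acting faithfully and transitively on a finite nonempty type `X`,
with point stabilizer `H = Stab(x₀)`.  If `D ≥ 1` and `2^(D-1) ≥ |H|` (i.e.
`D ≥ log₂ |H| + 1`), then the diagonal action of `G` on `D`-tuples `Fin D → X` has a regular
orbit: there is a tuple whose stabilizer `⋂ d, Stab (v d)` is trivial. -/
theorem regular_orbit_of_order_ge_log_stabilizer
    {G : Type*} [Group G] [Fintype G] {X : Type*} [Fintype X] [Nonempty X]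
    [MulAction G X] [FaithfulSMul G X] (htrans : MulAction.IsPretransitive G X)
    (x₀ : X) (D : ℕ) (hD : 1 ≤ D)
    (hcard : Nat.card (MulAction.stabilizer G x₀) ≤ 2 ^ (D - 1)) :
    ∃ v : Fin D → X, (⨅ d : Fin D, MulAction.stabilizer G (v d)) = ⊥ := by
  obtain ⟨n, rfl⟩ := Nat.exists_eq_add_of_le' hD
  obtain ⟨v, hv⟩ := MulAction.exists_inf_iInf_stabilizer_eq_bot (X := X) hcard
  refine ⟨Fin.cons x₀ v, ?_⟩
  rw [Fin.iInf_eq_zero_inf_succ]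
  simpa using hv
end

section
/- Let X be a finite type and D ∈ ℕ with D ≤ |X|. Then the set of orbits of the diagonal action of Equiv.Perm X on (Fin D → X) is in bijection with the set of equivalence relations (setoids) on Fin D; the bijection sends the orbit of a tuple x to the equivalence relation i ∼ j ↔ x(i) = x(j). In particular, the number of orbits equals the Bell number of D, the number of partitions of a set of D labelled objects. -/
/-- The equality pattern of a tuple `x : Fin D → X`, as an equivalence relation (setoid)
on the index set `Fin D`: `i ∼ j ↔ x i = x j`. -/
def eqPattern {X : Type*} {D : ℕ} (x : Fin D → X) : Setoid (Fin D) :=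
  ⟨fun i j => x i = x j,
    ⟨fun _ => rfl, fun h => h.symm, fun h₁ h₂ => h₁.trans h₂⟩⟩

/-- The Bell number `Bell D`: the number of partitions of a set of `D` labelled objects,
i.e. the number of equivalence relations on `Fin D`. -/
noncomputable def bellNumber (D : ℕ) : ℕ := Nat.card (Setoid (Fin D))

theorem eqPattern_smul {X : Type*} {D : ℕ} (σ : Equiv.Perm X) (x : Fin D → X) :
    eqPattern (σ • x) = eqPattern x :=
  Setoid.ext fun _ _ => σ.injective.eq_iff

/-- Tuples in a finite type with the same equality pattern are related by a permutation. -/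
theorem exists_perm_smul_eq_of_eqPattern_eq {X : Type*} [Finite X] {D : ℕ} {x y : Fin D → X}
    (h : eqPattern x = eqPattern y) : ∃ σ : Equiv.Perm X, σ • y = x := by
  classical
  let e : Set.range y ≃ Set.range x :=
    (Setoid.quotientKerEquivRange y).symm.trans
      ((Quotient.congrRight fun i j => (Setoid.ext_iff.1 h i j).symm).trans
        (Setoid.quotientKerEquivRange x))
  have he (i : Fin D) : e ⟨y i, i, rfl⟩ = ⟨x i, i, rfl⟩ := by
    have hi : (Setoid.quotientKerEquivRange y).symm ⟨y i, i, rfl⟩ =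
        Quotient.mk (Setoid.ker y) i :=
      (Equiv.symm_apply_eq _).2 rfl
    exact congrArg (fun q => Setoid.quotientKerEquivRange x (Quotient.congrRight _ q)) hi
  refine ⟨e.extendSubtype, funext fun i => ?_⟩
  exact (e.extendSubtype_apply_of_mem (y i) ⟨i, rfl⟩).trans (congrArg Subtype.val (he i))

theorem eqPattern_surjective {X : Type*} [Fintype X] {D : ℕ} (hD : D ≤ Fintype.card X) :
    Function.Surjective (eqPattern : (Fin D → X) → Setoid (Fin D)) := by
  intro r
  obtain ⟨f⟩ : Nonempty (Fin D ↪ X) :=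
    Function.Embedding.nonempty_of_card_le (by simpa using hD)
  refine ⟨fun i => f (Quotient.mk r i).out, Setoid.ext fun i j => ?_⟩
  exact f.injective.eq_iff.trans (Quotient.out_injective.eq_iff.trans Quotient.eq)

/-- **Orbits of the diagonal symmetric-group action on `X^D` correspond to set partitions.**
For `D ≤ |X|`, the orbit space of the diagonal action of `Equiv.Perm X` on `Fin D → X` is in
bijection with the setoids on `Fin D`, the bijection sending the orbit of a tuple `x` to its
equality pattern `i ∼ j ↔ x i = x j`.  In particular the number of orbits is the Bell
number of `D`. -/
theorem perm_diagonal_orbits_equiv_setoids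
    {X : Type*} [Fintype X] {D : ℕ} (hD : D ≤ Fintype.card X) :
    ∃ e : Quotient (MulAction.orbitRel (Equiv.Perm X) (Fin D → X)) ≃ Setoid (Fin D),
      (∀ x : Fin D → X,
        e (Quotient.mk (MulAction.orbitRel (Equiv.Perm X) (Fin D → X)) x) = eqPattern x) ∧
      Nat.card (Quotient (MulAction.orbitRel (Equiv.Perm X) (Fin D → X))) = bellNumber D := by
  let F : Quotient (MulAction.orbitRel (Equiv.Perm X) (Fin D → X)) → Setoid (Fin D) :=
    Quotient.lift eqPattern (by
      rintro _ y ⟨σ, rfl⟩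
      exact eqPattern_smul σ y)
  have hF : Function.Bijective F := by
    refine ⟨?_, fun r => ?_⟩
    · rintro ⟨x⟩ ⟨y⟩ h
      exact Quotient.sound (exists_perm_smul_eq_of_eqPattern_eq h)
    · obtain ⟨x, rfl⟩ := eqPattern_surjective hD r
      exact ⟨Quotient.mk _ x, rfl⟩
  exact ⟨Equiv.ofBijective F hF, fun _ => rfl, Nat.card_congr (Equiv.ofBijective F hF)⟩
end

section
/- Let G be a finite group acting transitively on finite nonempty types X and Y, with all point stabilizers nontrivial proper subgroups of G. Suppose that the stabilizer of some (equivalently, every) point of Y is not contained in the kernel of the G-action on X, and the stabilizer of some (equivalently, every) point of X is not contained in the kernel of the G-action on Y. Then there exist x ∈ X and y ∈ Y such that |Stab(x) ∩ Stab(y)| < |Stab(x)| and |Stab(x) ∩ Stab(y)| < |Stab(y)|; that is, the product G-set X × Y (with diagonal action) has an orbit whose stabilizer is strictly smaller than the stabilizers of both factors. -/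
theorem Subgroup.card_inf_lt_left {G : Type*} [Group G] [Finite G] {H K : Subgroup G}
    (h : ¬ H ≤ K) : Nat.card (↥(H ⊓ K)) < Nat.card H :=
  lt_of_not_ge fun hle => h (inf_eq_left.mp (Subgroup.eq_of_le_of_card_ge inf_le_left hle))

theorem Subgroup.card_inf_lt_of_not_le_of_card_le {G : Type*} [Group G] [Finite G]
    {H K : Subgroup G} (h : ¬ H ≤ K) (hc : Nat.card H ≤ Nat.card K) :
    Nat.card (↥(H ⊓ K)) < Nat.card H ∧ Nat.card (↥(H ⊓ K)) < Nat.card K :=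
  ⟨card_inf_lt_left h, (card_inf_lt_left h).trans_le hc⟩

theorem MulAction.card_stabilizer_eq_of_isPretransitive (G : Type*) [Group G] {X : Type*}
    [MulAction G X] [MulAction.IsPretransitive G X] (x x' : X) :
    Nat.card (MulAction.stabilizer G x) = Nat.card (MulAction.stabilizer G x') := by
  obtain ⟨g, rfl⟩ := MulAction.exists_smul_eq G x x'
  exact Nat.card_congr (MulAction.stabilizerEquivStabilizer (g := g) rfl).toEquiv

theorem MulAction.exists_not_le_stabilizer_of_not_le_ker {G : Type*} [Group G] {X : Type*}
    [MulAction G X] {H : Subgroup G} (h : ¬ H ≤ (MulAction.toPermHom G X).ker) :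
    ∃ x : X, ¬ H ≤ MulAction.stabilizer G x := by
  contrapose! h
  exact fun g hg => MonoidHom.mem_ker.mpr (Equiv.ext fun x => h x hg)

/-- **Product `G`-sets have a strictly larger orbit (Theorem 4(ii)).**
Let a finite group `G` act transitively on finite nonempty types `X` and `Y` with all point
stabilizers nontrivial proper subgroups.  If the stabilizer of some point of `Y` is not
contained in the kernel of the `G`-action on `X`, and the stabilizer of some point of `X`
is not contained in the kernel of the `G`-action on `Y`, then the diagonal action on
`X × Y` has an orbit whose stabilizer `Stab(x) ⊓ Stab(y)` is strictly smaller than the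
stabilizers of both factors. -/
theorem product_action_has_strictly_larger_orbit
    {G : Type*} [Group G] [Fintype G]
    {X : Type*} [Fintype X] [Nonempty X] {Y : Type*} [Fintype Y] [Nonempty Y]
    [MulAction G X] [MulAction G Y]
    (htransX : MulAction.IsPretransitive G X) (htransY : MulAction.IsPretransitive G Y)
    (hX : ∀ x : X, MulAction.stabilizer G x ≠ ⊥ ∧ MulAction.stabilizer G x ≠ ⊤)
    (hY : ∀ y : Y, MulAction.stabilizer G y ≠ ⊥ ∧ MulAction.stabilizer G y ≠ ⊤)
    (hYX : ∃ y : Y, ¬ MulAction.stabilizer G y ≤ (MulAction.toPermHom G X).ker)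
    (hXY : ∃ x : X, ¬ MulAction.stabilizer G x ≤ (MulAction.toPermHom G Y).ker) :
    ∃ (x : X) (y : Y),
      Nat.card (↥(MulAction.stabilizer G x ⊓ MulAction.stabilizer G y))
          < Nat.card (MulAction.stabilizer G x) ∧
      Nat.card (↥(MulAction.stabilizer G x ⊓ MulAction.stabilizer G y))
          < Nat.card (MulAction.stabilizer G y) := by
  obtain ⟨x, hx⟩ := hXY
  obtain ⟨y, hxy⟩ := MulAction.exists_not_le_stabilizer_of_not_le_ker hx
  obtain ⟨y', hy'⟩ := hYX
  obtain ⟨x', hyx'⟩ := MulAction.exists_not_le_stabilizer_of_not_le_ker hy'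
  rcases le_total (Nat.card (MulAction.stabilizer G x)) (Nat.card (MulAction.stabilizer G y))
    with hle | hle
  · exact ⟨x, y, Subgroup.card_inf_lt_of_not_le_of_card_le hxy hle⟩
  · rw [MulAction.card_stabilizer_eq_of_isPretransitive G y y',
      MulAction.card_stabilizer_eq_of_isPretransitive G x x'] at hle
    refine ⟨x', y', ?_⟩
    rw [inf_comm]
    exact (Subgroup.card_inf_lt_of_not_le_of_card_le hyx' hle).symm
end

section
/- Let G be a finite group acting on finite types N and O, acting on functions by (g • x)(i) = x(g⁻¹ • i). Let ψ : (N → ℝ) → (O → ℝ) be G-equivariant, let K ⊆ (N → ℝ) be compact, and let K_sym = {g • x : g ∈ G, x ∈ K}. If f : (N → ℝ) → (O → ℝ) satisfies max_{o ∈ O} |ψ(x)(o) − f(x)(o)| ≤ ε for all x ∈ K_sym, then the Reynolds-symmetrized function f_sym(x) = (1/|G|) · Σ_{g ∈ G} g⁻¹ • f(g • x) satisfies max_{o ∈ O} |ψ(x)(o) − f_sym(x)(o)| ≤ ε for all x ∈ K, and f_sym is G-equivariant. -/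
/-- **The Reynolds operator preserves approximation and produces equivariance.**
Let a finite group `G` act on finite types `N` and `O`, hence on signals by
`(g • x) i = x (g⁻¹ • i)`.  If `ψ` is `G`-equivariant and `f` approximates `ψ` within `ε`
(uniformly over output coordinates) on the symmetrization `K_sym` of a compact set `K`,
then the Reynolds-symmetrized function
`f_sym x = (1/|G|) ∑_g g⁻¹ • f (g • x)`, i.e. `f_sym x o = (1/|G|) ∑_g f (g • x) (g • o)`,
approximates `ψ` within `ε` on `K` and is `G`-equivariant. -/
theorem reynolds_equivariant_approximation
    {G : Type*} [Group G] [Fintype G] {N : Type*} [Fintype N] {O : Type*} [Fintype O]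
    [MulAction G N] [MulAction G O]
    (ψ : (N → ℝ) → (O → ℝ))
    (hequiv : ∀ (g : G) (x : N → ℝ),
      ψ (fun i => x (g⁻¹ • i)) = fun o => ψ x (g⁻¹ • o))
    (K : Set (N → ℝ)) (hK : IsCompact K) (ε : ℝ) (f : (N → ℝ) → (O → ℝ))
    (hf : ∀ y ∈ {y : N → ℝ | ∃ (g : G) (x : N → ℝ), x ∈ K ∧ y = fun i => x (g⁻¹ • i)},
      ∀ o : O, |ψ y o - f y o| ≤ ε) :
    (∀ x ∈ K, ∀ o : O,
      |ψ x o -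
        (1 / (Fintype.card G : ℝ)) * ∑ g : G, f (fun i => x (g⁻¹ • i)) (g • o)| ≤ ε) ∧
    (∀ (g : G) (x : N → ℝ),
      (fun o => (1 / (Fintype.card G : ℝ)) *
          ∑ g' : G, f (fun i => x (g⁻¹ • (g'⁻¹ • i))) (g' • o)) =
      fun o => (1 / (Fintype.card G : ℝ)) *
          ∑ g' : G, f (fun i => x (g'⁻¹ • i)) (g' • (g⁻¹ • o))) := by
  refine ⟨fun x hx o => ?_, fun g x => ?_⟩
  · have hcard : (0 : ℝ) < Fintype.card G := by exact_mod_cast Fintype.card_pos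
    have hterm : ∀ g : G, |ψ x o - f (fun i => x (g⁻¹ • i)) (g • o)| ≤ ε := fun g => by
      simpa [hequiv] using hf _ ⟨g, x, hx, rfl⟩ (g • o)
    have hsum : ψ x o - (1 / (Fintype.card G : ℝ)) * ∑ g : G, f (fun i => x (g⁻¹ • i)) (g • o)
        = (∑ g : G, (ψ x o - f (fun i => x (g⁻¹ • i)) (g • o))) / Fintype.card G := by
      rw [Finset.sum_sub_distrib, Finset.sum_const, Finset.card_univ, nsmul_eq_mul]
      field_simp
    rw [hsum, abs_div, abs_of_pos hcard, div_le_iff₀ hcard]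
    calc |∑ g : G, (ψ x o - f (fun i => x (g⁻¹ • i)) (g • o))|
        ≤ ∑ g : G, |ψ x o - f (fun i => x (g⁻¹ • i)) (g • o)| := Finset.abs_sum_le_sum_abs _ _
      _ ≤ ∑ _g : G, ε := Finset.sum_le_sum fun g _ => hterm g
      _ = ε * Fintype.card G := by
        rw [Finset.sum_const, Finset.card_univ, nsmul_eq_mul, mul_comm]
  · funext o
    congr 1
    exact Fintype.sum_equiv (Equiv.mulRight g) _ _ fun g' => by simp [mul_smul]
end

section
/- Let G be a finite group acting on finite types N and O, acting on functions by (g • x)(i) = x(g⁻¹ • i). For a matrix Φ : O → N → ℝ, let T_Φ : (N → ℝ) → (O → ℝ) be the linear map T_Φ(x)(o) = Σ_{i ∈ N} Φ(o, i) · x(i). Then T_Φ is G-equivariant (T_Φ(g • x) = g • T_Φ(x) for all g ∈ G and x) if and only if the entries of Φ are constant on the orbits of the diagonal G-action on O × N, i.e., Φ(g • o, g • i) = Φ(o, i) for all g ∈ G, o ∈ O, i ∈ N. -/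
/-- **Equivariance of a linear layer is equivalent to parameter-sharing.**
Let a finite group `G` act on finite types `N` and `O`, hence on signals by
`(g • x) i = x (g⁻¹ • i)`.  The linear map `T_Φ x o = ∑ i, Φ o i * x i` is `G`-equivariant
iff the entries of `Φ` are constant on the orbits of the diagonal `G`-action on `O × N`,
i.e. `Φ (g • o) (g • i) = Φ o i` for all `g`, `o`, `i`. -/
theorem linear_map_equivariant_iff_parameter_sharing
    {G : Type*} [Group G] [Fintype G] {N : Type*} [Fintype N] {O : Type*} [Fintype O]
    [MulAction G N] [MulAction G O] (Φ : O → N → ℝ) :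
    (∀ (g : G) (x : N → ℝ),
      (fun o => ∑ i : N, Φ o i * x (g⁻¹ • i)) =
        fun o => ∑ i : N, Φ (g⁻¹ • o) i * x i) ↔
    (∀ (g : G) (o : O) (i : N), Φ (g • o) (g • i) = Φ o i) := by
  classical
  have reindex (g : G) (x : N → ℝ) (o : O) :
      ∑ i, Φ o i * x (g⁻¹ • i) = ∑ i, Φ o (g • i) * x i := by
    rw [← Equiv.sum_comp (MulAction.toPerm g)]
    simp
  constructor
  · intro h g o i
    have key := congrFun (h g (Pi.single i 1)) (g • o)
    simp only [reindex] at key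
    simpa [Pi.single_apply] using key
  · intro h g x
    funext o
    rw [reindex]
    refine Finset.sum_congr rfl fun i _ => ?_
    rw [← h g (g⁻¹ • o) i, smul_inv_smul]
end
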